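/- arXiv:1312.4943 — 5 statements merged into one kernel-verified Lean document; each statement's English description precedes it below -/
import Mathlib

section
/- (von Neumann) Let H₁ and H₂ be real Hilbert spaces and D : H₁ →ₗ. H₂ a densely defined closed linear operator with adjoint D*. Then for every x ∈ H₁ there exists a unique y ∈ D(D) such that D y ∈ D(D*) and y + D*(D y) = x; moreover this y satisfies ‖y‖ ≤ ‖x‖, so the solution operator x ↦ y, i.e. (I + D*D)⁻¹, is everywhere defined and bounded with norm at most 1. -/
open RealInnerProductSpace

namespace LinearPMap

variable {𝕜 E F : Type*} [RCLike 𝕜] [NormedAddCommGroup E] [InnerProductSpace 𝕜 E]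
  [NormedAddCommGroup F] [InnerProductSpace 𝕜 F] [CompleteSpace E]

/-- For a closed operator `T`, every `x` splits as `y + (x - y)` with `y` in the domain of `T` and
`⟪x - y, z⟫ = ⟪T y, T z⟫` for all `z` in the domain: `(y, T y)` is the orthogonal projection of
`(x, 0)` onto the graph of `T`. -/
theorem IsClosed.exists_inner_sub_eq_inner_apply [CompleteSpace F] {T : E →ₗ.[𝕜] F}
    (hT : T.IsClosed) (x : E) :
    ∃ y : T.domain, ∀ z : T.domain, inner 𝕜 (x - y) (z : E) = inner 𝕜 (T y) (T z) := by
  let K : Submodule 𝕜 (WithLp 2 (E × F)) :=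
    T.graph.comap (WithLp.linearEquiv 2 𝕜 (E × F)).toLinearMap
  have hK : _root_.IsClosed (K : Set (WithLp 2 (E × F))) :=
    _root_.IsClosed.preimage (WithLp.prod_continuous_ofLp 2 E F) hT
  have : CompleteSpace K := hK.completeSpace_coe
  obtain ⟨p, hp, hperp⟩ :=
    Submodule.HasOrthogonalProjection.exists_orthogonal (K := K) (WithLp.toLp 2 (x, (0 : F)))
  obtain ⟨y, hy, hTy⟩ := T.mem_graph_iff.1 (Submodule.mem_comap.1 hp)
  refine ⟨y, fun z ↦ ?_⟩
  have hz : WithLp.toLp 2 ((z : E), T z) ∈ K := T.mem_graph z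
  have h := Submodule.inner_left_of_mem_orthogonal hz hperp
  rw [WithLp.prod_inner_apply] at h
  simpa [hy, hTy, ← sub_eq_add_neg, sub_eq_zero] using h

/-- If `T` is densely defined, then `‖y‖ ≤ ‖y + T† (T y)‖`. -/
theorem norm_le_norm_add_adjoint_apply {T : E →ₗ.[𝕜] F} (hT : Dense (T.domain : Set E))
    (y : T.domain) (hy : T y ∈ T.adjoint.domain) :
    ‖(y : E)‖ ≤ ‖(y : E) + T.adjoint ⟨T y, hy⟩‖ := by
  have h : ‖(y : E)‖ * ‖(y : E)‖ ≤ ‖(y : E) + T.adjoint ⟨T y, hy⟩‖ * ‖(y : E)‖ := by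
    refine le_trans ?_ (re_inner_le_norm (𝕜 := 𝕜) _ _)
    rw [inner_add_left, adjoint_isFormalAdjoint hT ⟨T y, hy⟩ y, _root_.map_add,
      inner_self_eq_norm_mul_norm]
    exact le_add_of_nonneg_right inner_self_nonneg
  rcases (norm_nonneg (y : E)).eq_or_lt with h0 | h0
  · exact h0 ▸ norm_nonneg _
  · exact le_of_mul_le_mul_right h h0

end LinearPMap

/-- **von Neumann.** For a densely defined closed operator `D : H₁ →ₗ. H₂`
with adjoint `D*`, for every `x ∈ H₁` there is a unique `y ∈ D(D)` with `D y ∈ D(D*)` and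
`y + D* (D y) = x`; moreover `‖y‖ ≤ ‖x‖`, i.e. `(I + D* D)⁻¹` is everywhere defined and
bounded with norm at most `1`. -/
theorem vonNeumann_id_add_adjoint_comp_self_surjective
    {H₁ H₂ : Type*} [NormedAddCommGroup H₁] [InnerProductSpace ℝ H₁] [CompleteSpace H₁]
    [NormedAddCommGroup H₂] [InnerProductSpace ℝ H₂] [CompleteSpace H₂]
    (D : H₁ →ₗ.[ℝ] H₂) (hdense : Dense (D.domain : Set H₁)) (hclosed : D.IsClosed) :
    (∀ x : H₁, ∃! y : D.domain,
        ∃ hmem : D y ∈ D.adjoint.domain, (y : H₁) + D.adjoint ⟨D y, hmem⟩ = x) ∧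
    (∀ (x : H₁) (y : D.domain) (hmem : D y ∈ D.adjoint.domain),
        (y : H₁) + D.adjoint ⟨D y, hmem⟩ = x → ‖(y : H₁)‖ ≤ ‖x‖) := by
  refine ⟨fun x ↦ ?_, fun x y hmem hx ↦
    hx ▸ LinearPMap.norm_le_norm_add_adjoint_apply hdense y hmem⟩
  obtain ⟨y, hy⟩ := hclosed.exists_inner_sub_eq_inner_apply x
  have hmem : D y ∈ D.adjoint.domain := LinearPMap.mem_adjoint_domain_of_exists _ ⟨x - y, hy⟩
  have hadj : D.adjoint ⟨D y, hmem⟩ = x - y := LinearPMap.adjoint_apply_eq hdense _ hy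
  refine ⟨y, ⟨hmem, by rw [hadj, add_sub_cancel]⟩, ?_⟩
  rintro z ⟨hz, hzx⟩
  have hsub : D (z - y) ∈ D.adjoint.domain := by
    rw [D.map_sub]
    exact sub_mem hz hmem
  have hzero : ((z - y : D.domain) : H₁) + D.adjoint ⟨D (z - y), hsub⟩ = 0 := by
    have : (⟨D (z - y), hsub⟩ : D.adjoint.domain) = ⟨D z, hz⟩ - ⟨D y, hmem⟩ :=
      Subtype.ext (D.map_sub z y)
    rw [this, D.adjoint.map_sub, hadj, ← hzx, Submodule.coe_sub]
    abel
  have hnorm := LinearPMap.norm_le_norm_add_adjoint_apply hdense (z - y) hsub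
  rw [hzero, norm_zero, norm_le_zero_iff, Submodule.coe_sub, sub_eq_zero] at hnorm
  exact Subtype.ext hnorm
end

section
/- Let H be a separable real Hilbert space and let Q, Σ : H → H be bounded self-adjoint positive operators such that Q is trace class in the sense that for some Hilbert basis (e_i) of H the family (⟨Q e_i, e_i⟩) is summable. Let (Σ + Q)^{1/2} denote the positive square root of the positive self-adjoint operator Σ + Q. Then there exists a bounded operator T : H → H such that T ∘ (Σ + Q)^{1/2} = Q and T is Hilbert–Schmidt: for every Hilbert basis (f_j) of H, the family (‖T f_j‖²) is summable. -/
open RealInnerProductSpace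

/-- Cauchy–Schwarz inequality for the form `⟪Q x, y⟫` of a positive operator. -/
theorem inner_apply_sq_le_of_isSelfAdjoint_of_nonneg
    {H : Type*} [NormedAddCommGroup H] [InnerProductSpace ℝ H] [CompleteSpace H]
    {Q : H →L[ℝ] H} (hQsa : IsSelfAdjoint Q) (hQpos : ∀ h : H, 0 ≤ ⟪Q h, h⟫) (x y : H) :
    ⟪Q x, y⟫ ^ 2 ≤ ⟪Q x, x⟫ * ⟪Q y, y⟫ := by
  have h := LinearMap.BilinForm.apply_mul_apply_le_of_forall_zero_le
    ((innerₗ H).comp (Q : H →ₗ[ℝ] H)) hQpos x y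
  have hsymm : ⟪Q y, x⟫ = ⟪Q x, y⟫ := by
    rw [real_inner_comm, ← ContinuousLinearMap.adjoint_inner_left, hQsa.adjoint_eq]
  simpa [hsymm, sq] using h

/-- Douglas factorization: an operator dominated in norm by `B` factors through `B`, by an operator
vanishing on the orthogonal complement of the range of `B`. -/
theorem ContinuousLinearMap.exists_comp_eq_of_norm_le
    {E F G : Type*} [NormedAddCommGroup E] [NormedSpace ℝ E]
    [NormedAddCommGroup F] [InnerProductSpace ℝ F] [CompleteSpace F]
    [NormedAddCommGroup G] [NormedSpace ℝ G] [CompleteSpace G]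
    (A : E →L[ℝ] G) (B : E →L[ℝ] F) (C : ℝ) (h : ∀ x, ‖A x‖ ≤ C * ‖B x‖) :
    ∃ T : F →L[ℝ] G, T.comp B = A ∧ ∀ y ∈ (B.range)ᗮ, T y = 0 := by
  let K : Submodule ℝ F := (B.range).topologicalClosure
  have : CompleteSpace K := (B.range).isClosed_topologicalClosure.completeSpace_coe
  have hK : ∀ x, B x ∈ K := fun x => (B.range).le_topologicalClosure ⟨x, rfl⟩
  let e : E →ₗ[ℝ] K := (B : E →ₗ[ℝ] F).codRestrict K hK
  have he : DenseRange e := by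
    intro y
    rw [closure_subtype, ← Set.range_comp]
    exact y.2
  refine ⟨((A : E →ₗ[ℝ] G).extendOfNorm e).comp K.orthogonalProjectionOnto, ?_, ?_⟩
  · ext x
    have hx : K.orthogonalProjectionOnto (B x) = e x :=
      K.orthogonalProjectionOnto_mem_subspace_eq_self (e x)
    simpa [hx] using LinearMap.extendOfNorm_eq (f := (A : E →ₗ[ℝ] G)) he ⟨C, h⟩ x
  · intro y hy
    have hy' : y ∈ Kᗮ := by rwa [Submodule.orthogonal_closure]
    simp [Submodule.orthogonalProjectionOnto_apply_of_mem_orthogonal hy']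

/-- If `T` vanishes on the orthogonal complement of the range of `B`, then a bound for
`y ↦ ⟪x, T y⟫` on the range of `B` bounds the norm of `T† x`. -/
theorem ContinuousLinearMap.norm_adjoint_apply_le_of_range
    {E F G : Type*} [NormedAddCommGroup E] [NormedSpace ℝ E]
    [NormedAddCommGroup F] [InnerProductSpace ℝ F] [CompleteSpace F]
    [NormedAddCommGroup G] [InnerProductSpace ℝ G] [CompleteSpace G]
    {T : F →L[ℝ] G} {B : E →L[ℝ] F} (hT : ∀ y ∈ (B.range)ᗮ, T y = 0)
    {x : G} {c : ℝ} (hc : 0 ≤ c) (h : ∀ z, ⟪x, T (B z)⟫ ≤ c * ‖B z‖) :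
    ‖adjoint T x‖ ≤ c := by
  have hmem : adjoint T x ∈ closure (B.range : Set F) := by
    rw [← Submodule.topologicalClosure_coe, ← Submodule.orthogonal_orthogonal_eq_closure]
    intro y hy
    rw [adjoint_inner_right, hT y hy, inner_zero_left]
  have hle : closure (B.range : Set F) ⊆ {y | ⟪x, T y⟫ ≤ c * ‖y‖} := by
    refine closure_minimal ?_ (isClosed_le (by fun_prop) (by fun_prop))
    rintro _ ⟨z, rfl⟩
    exact h z
  rcases (norm_nonneg (adjoint T x)).eq_or_lt with h0 | hpos
  · rwa [← h0]
  · refine le_of_mul_le_mul_right ?_ hpos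
    rw [← real_inner_self_eq_norm_mul_norm, adjoint_inner_left]
    exact hle hmem

/-- Parseval's identity in a real Hilbert space. -/
theorem HilbertBasis.hasSum_inner_sq
    {F : Type*} [NormedAddCommGroup F] [InnerProductSpace ℝ F]
    {κ : Type*} (f : HilbertBasis κ ℝ F) (x : F) :
    HasSum (fun j => ⟪x, f j⟫ ^ 2) (‖x‖ ^ 2) := by
  simpa only [real_inner_comm x, ← sq, real_inner_self_eq_norm_sq] using
    f.hasSum_inner_mul_inner x x

/-- An operator whose adjoint has square-summable norms along one Hilbert basis is
Hilbert–Schmidt. -/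
theorem HilbertBasis.summable_norm_sq_of_adjoint
    {F G : Type*} [NormedAddCommGroup F] [InnerProductSpace ℝ F] [CompleteSpace F]
    [NormedAddCommGroup G] [InnerProductSpace ℝ G] [CompleteSpace G]
    {ι κ : Type*} (e : HilbertBasis ι ℝ G) (f : HilbertBasis κ ℝ F) (T : F →L[ℝ] G)
    (h : Summable fun i => ‖ContinuousLinearMap.adjoint T (e i)‖ ^ 2) :
    Summable fun j => ‖T (f j)‖ ^ 2 := by
  have parseval_left (i : ι) : HasSum (fun j => ⟪T (f j), e i⟫ ^ 2)
      (‖ContinuousLinearMap.adjoint T (e i)‖ ^ 2) := by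
    simpa only [ContinuousLinearMap.adjoint_inner_left, real_inner_comm (e i)] using
      f.hasSum_inner_sq (ContinuousLinearMap.adjoint T (e i))
  have hprod : Summable fun p : ι × κ => ⟪T (f p.2), e p.1⟫ ^ 2 :=
    (summable_prod_of_nonneg fun p => sq_nonneg _).2
      ⟨fun i => (parseval_left i).summable, by simpa only [(parseval_left _).tsum_eq] using h⟩
  simpa only [Prod.fst_swap, Prod.snd_swap, (e.hasSum_inner_sq _).tsum_eq] using hprod.prod_symm.prod

/-- Let `Q, Σ` be bounded self-adjoint positive operators on a separable
real Hilbert space `H`, with `Q` trace class in the summable sense. If `R` is the positive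
self-adjoint square root of `Σ + Q`, then there is a bounded operator `T` with
`T ∘ R = Q` which is Hilbert–Schmidt: `(‖T f_j‖²)` is summable over every Hilbert basis. -/
theorem traceClass_comp_inv_sqrt_hilbertSchmidt
    {H : Type*} [NormedAddCommGroup H] [InnerProductSpace ℝ H] [CompleteSpace H]
    [TopologicalSpace.SeparableSpace H]
    (Q S : H →L[ℝ] H)
    (hQsa : IsSelfAdjoint Q) (hQpos : ∀ h : H, 0 ≤ ⟪Q h, h⟫)
    (hSsa : IsSelfAdjoint S) (hSpos : ∀ h : H, 0 ≤ ⟪S h, h⟫)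
    (ι : Type*) (e : HilbertBasis ι ℝ H)
    (htr : Summable (fun i => ⟪Q (e i), e i⟫))
    (R : H →L[ℝ] H) (hRsa : IsSelfAdjoint R) (hRpos : ∀ h : H, 0 ≤ ⟪R h, h⟫)
    (hRsq : R.comp R = S + Q) :
    ∃ T : H →L[ℝ] H,
      T.comp R = Q ∧
      ∀ (κ : Type*) (f : HilbertBasis κ ℝ H), Summable (fun j => ‖T (f j)‖ ^ 2) := by
  have hQR (h : H) : ⟪Q h, h⟫ ≤ ‖R h‖ ^ 2 := by
    have hR : ‖R h‖ ^ 2 = ⟪S h, h⟫ + ⟪Q h, h⟫ := by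
      rw [← inner_add_left, ← add_apply, ← hRsq,
        ContinuousLinearMap.comp_apply, ← real_inner_self_eq_norm_sq,
        ← ContinuousLinearMap.adjoint_inner_left, hRsa.adjoint_eq]
    linarith [hSpos h]
  have hform (x h : H) : ⟪x, Q h⟫ ≤ √⟪Q x, x⟫ * ‖R h‖ := by
    rw [← ContinuousLinearMap.adjoint_inner_left, hQsa.adjoint_eq]
    refine le_of_sq_le_sq ?_ (by positivity)
    rw [mul_pow, Real.sq_sqrt (hQpos x)]
    exact (inner_apply_sq_le_of_isSelfAdjoint_of_nonneg hQsa hQpos x h).trans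
      (mul_le_mul_of_nonneg_left (hQR h) (hQpos x))
  have hnorm (h : H) : ‖Q h‖ ≤ √‖Q‖ * ‖R h‖ := by
    rcases (norm_nonneg (Q h)).eq_or_lt with h0 | hpos
    · rw [← h0]
      positivity
    · refine le_of_mul_le_mul_right ?_ hpos
      have hQQ : ⟪Q (Q h), Q h⟫ ≤ ‖Q‖ * ‖Q h‖ ^ 2 := by
        rw [sq, ← mul_assoc]
        exact (real_inner_le_norm _ _).trans
          (mul_le_mul_of_nonneg_right (Q.le_opNorm _) (norm_nonneg _))
      calc ‖Q h‖ * ‖Q h‖ = ⟪Q h, Q h⟫ := (real_inner_self_eq_norm_mul_norm _).symm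
        _ ≤ √⟪Q (Q h), Q h⟫ * ‖R h‖ := hform (Q h) h
        _ ≤ √(‖Q‖ * ‖Q h‖ ^ 2) * ‖R h‖ := by gcongr
        _ = √‖Q‖ * ‖R h‖ * ‖Q h‖ := by
          rw [Real.sqrt_mul (norm_nonneg _), Real.sqrt_sq (norm_nonneg _)]
          ring
  obtain ⟨T, hTR, hT⟩ := Q.exists_comp_eq_of_norm_le R _ hnorm
  refine ⟨T, hTR, fun κ f => e.summable_norm_sq_of_adjoint f T ?_⟩
  refine htr.of_nonneg_of_le (fun i => sq_nonneg _) fun i => ?_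
  rw [← Real.sq_sqrt (hQpos (e i))]
  gcongr
  refine ContinuousLinearMap.norm_adjoint_apply_le_of_range hT (Real.sqrt_nonneg _) fun z => ?_
  rw [← ContinuousLinearMap.comp_apply, hTR]
  exact hform (e i) z
end

section
/- Let H₁ and H₂ be real Hilbert spaces, A : H₁ → H₂ and A† : H₂ → H₁ bounded operators satisfying the Moore–Penrose equations (A A† A = A, A† A A† = A†, (A A†)* = A A†, (A† A)* = A† A), and set Π := A† A. Let Σ_u : H₁ → H₁ be a bounded self-adjoint positive operator with Π Σ_u = Σ_u Π, and let Σ_v : H₂ → H₂ be a bounded self-adjoint positive bijective operator (with bounded inverse) commuting with the projection A A†. Define Q_v := A† ∘ Σ_v ∘ (A†)* and B̂ := (A†)* ∘ Σ_u ∘ A* ∘ Σ_v⁻¹, and assume Σ_u + Q_v is bijective. Then the operator I + A* ∘ B̂ ∘ A : H₁ → H₁ is bijective and Π ∘ (I + A* B̂ A)⁻¹ = Q_v ∘ (Σ_u + Q_v)⁻¹. -/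
open RealInnerProductSpace

/-- If `Q` and `R` are mutually inverse in the corner `P M P` of the idempotent `P`, and `U`
commutes with `P`, then `1 + P U R` is a unit whenever `U + Q` is. -/
theorem isUnit_one_add_mul_of_corner_inverse {M : Type*} [Ring M] {P Q R U : M}
    (hU : P * U = U * P) (hPQ : P * Q = Q) (hQP : Q * P = Q) (hPR : P * R = R) (hRP : R * P = R)
    (hRQ : R * Q = P) (hQR : Q * R = P) (hS : IsUnit (U + Q)) :
    IsUnit (1 + P * U * R) := by
  have hPP : P * P = P := by
    nth_rewrite 2 [← hQR]
    rw [← mul_assoc, hPQ, hQR]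
  have hcorner : ∀ {X Y : M}, X * Y = P →
      (X + (1 - P)) * (Y + (1 - P)) = 1 + X * (1 - P) + (1 - P) * Y := by
    intro X Y hXY
    have : (X + (1 - P)) * (Y + (1 - P)) =
        X * Y + X * (1 - P) + (1 - P) * Y + (1 - P - P + P * P) := by noncomm_ring
    rw [this, hXY, hPP]
    abel
  have hunit : ∀ {X Y : M}, P * X = X → X * P = X → P * Y = Y → Y * P = Y →
      X * Y = P → Y * X = P → IsUnit (X + (1 - P)) := by
    intro X Y hPX hXP hPY hYP hXY hYX
    refine ⟨⟨X + (1 - P), Y + (1 - P), ?_, ?_⟩, rfl⟩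
    · rw [hcorner hXY, mul_sub, sub_mul, hXP, hPY]
      simp
    · rw [hcorner hYX, mul_sub, sub_mul, hYP, hPX]
      simp
  obtain ⟨S, hS⟩ := hS
  have hSP : Commute P (S : M) := by
    rw [hS]
    exact (show Commute P U from hU).add_right (show P * Q = Q * P by rw [hPQ, hQP])
  have hSiP : P * (↑S⁻¹ : M) = ↑S⁻¹ * P := hSP.units_inv_right
  have hW : IsUnit (S * P + (1 - P) : M) := by
    refine hunit (Y := ↑S⁻¹ * P) ?_ ?_ ?_ ?_ ?_ ?_
    · rw [← mul_assoc, hSP.eq, mul_assoc, hPP]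
    · rw [mul_assoc, hPP]
    · rw [← mul_assoc, hSiP, mul_assoc, hPP]
    · rw [mul_assoc, hPP]
    · rw [← hSiP, mul_assoc, ← mul_assoc P P, hPP, hSiP, Units.mul_inv_cancel_left]
    · rw [← hSP.eq, mul_assoc, ← mul_assoc P P, hPP, hSP.eq, Units.inv_mul_cancel_left]
  have hV : IsUnit (Q + (1 - P)) := hunit hPQ hQP hPR hRP hQR hRQ
  have hTV : (1 + P * U * R) * (Q + (1 - P)) = S * P + (1 - P) := by
    have : (1 + P * U * R) * (Q + (1 - P)) =
        Q + (1 - P) + P * U * (R * Q) + P * U * (R - R * P) := by noncomm_ring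
    rw [this, hRQ, hRP, hS, hU, mul_assoc U, hPP, add_mul, hQP]
    noncomm_ring
  obtain ⟨V, hV⟩ := hV
  rw [← hV] at hTV
  rw [← Units.isUnit_mul_units _ V, hTV]
  exact hW

/-- With `(A, A†)` a Moore–Penrose pair, `Π := A† A`, `Σ_u` bounded
self-adjoint positive commuting with `Π`, `Σ_v` bounded self-adjoint positive bijective
(with bounded inverse `Σ_v⁻¹`) commuting with `A A†`, `Q_v := A† Σ_v (A†)*`,
`B̂ := (A†)* Σ_u A* Σ_v⁻¹`, and `Σ_u + Q_v` bijective, the operator `I + A* B̂ A` is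
bijective and `Π ∘ (I + A* B̂ A)⁻¹ = Q_v ∘ (Σ_u + Q_v)⁻¹`. -/
theorem optimal_smoothing_operator_identity
    {H₁ H₂ : Type*} [NormedAddCommGroup H₁] [InnerProductSpace ℝ H₁] [CompleteSpace H₁]
    [NormedAddCommGroup H₂] [InnerProductSpace ℝ H₂] [CompleteSpace H₂]
    (A : H₁ →L[ℝ] H₂) (Adag : H₂ →L[ℝ] H₁)
    (h1 : A.comp (Adag.comp A) = A)
    (h2 : Adag.comp (A.comp Adag) = Adag)
    (h3 : ContinuousLinearMap.adjoint (A.comp Adag) = A.comp Adag)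
    (h4 : ContinuousLinearMap.adjoint (Adag.comp A) = Adag.comp A)
    (Su : H₁ →L[ℝ] H₁) (hSu_sa : IsSelfAdjoint Su) (hSu_pos : ∀ h : H₁, 0 ≤ ⟪Su h, h⟫)
    (hSu_comm : (Adag.comp A).comp Su = Su.comp (Adag.comp A))
    (Sv : H₂ →L[ℝ] H₂) (hSv_sa : IsSelfAdjoint Sv) (hSv_pos : ∀ h : H₂, 0 ≤ ⟪Sv h, h⟫)
    (Svinv : H₂ →L[ℝ] H₂)
    (hSv_inv₁ : Sv.comp Svinv = ContinuousLinearMap.id ℝ H₂)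
    (hSv_inv₂ : Svinv.comp Sv = ContinuousLinearMap.id ℝ H₂)
    (hSv_comm : Sv.comp (A.comp Adag) = (A.comp Adag).comp Sv)
    (hbij : Function.Bijective
      ⇑(Su + Adag.comp (Sv.comp (ContinuousLinearMap.adjoint Adag)))) :
    Function.Bijective
      ⇑(ContinuousLinearMap.id ℝ H₁ +
        (ContinuousLinearMap.adjoint A).comp
          (((ContinuousLinearMap.adjoint Adag).comp
              (Su.comp ((ContinuousLinearMap.adjoint A).comp Svinv))).comp A)) ∧
    ∀ y z : H₁,
      (ContinuousLinearMap.id ℝ H₁ +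
          (ContinuousLinearMap.adjoint A).comp
            (((ContinuousLinearMap.adjoint Adag).comp
                (Su.comp ((ContinuousLinearMap.adjoint A).comp Svinv))).comp A)) y =
        (Su + Adag.comp (Sv.comp (ContinuousLinearMap.adjoint Adag))) z →
      (Adag.comp A) y = (Adag.comp (Sv.comp (ContinuousLinearMap.adjoint Adag))) z := by
  have e1 : ∀ x, A (Adag (A x)) = A x := fun x => DFunLike.congr_fun h1 x
  have e2 : ∀ x, Adag (A (Adag x)) = Adag x := fun x => DFunLike.congr_fun h2 x
  have e3 : ∀ x, ContinuousLinearMap.adjoint Adag (ContinuousLinearMap.adjoint A x) =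
      A (Adag x) := by
    intro x
    rw [ContinuousLinearMap.adjoint_comp] at h3
    exact DFunLike.congr_fun h3 x
  have e4 : ∀ x, ContinuousLinearMap.adjoint A (ContinuousLinearMap.adjoint Adag x) =
      Adag (A x) := by
    intro x
    rw [ContinuousLinearMap.adjoint_comp] at h4
    exact DFunLike.congr_fun h4 x
  have e5 : ∀ x, Adag (A (ContinuousLinearMap.adjoint A x)) = ContinuousLinearMap.adjoint A x := by
    intro x
    have h := congrArg ContinuousLinearMap.adjoint h1
    rw [ContinuousLinearMap.adjoint_comp, h4] at h
    exact DFunLike.congr_fun h x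
  have e6 : ∀ x, ContinuousLinearMap.adjoint Adag (Adag (A x)) =
      ContinuousLinearMap.adjoint Adag x := by
    intro x
    have h := congrArg ContinuousLinearMap.adjoint h2
    rw [← ContinuousLinearMap.comp_assoc, ContinuousLinearMap.adjoint_comp, h4] at h
    simpa using DFunLike.congr_fun h x
  have eU : ∀ x, Adag (A (Su x)) = Su (Adag (A x)) := fun x => DFunLike.congr_fun hSu_comm x
  have eV : ∀ x, Sv (A (Adag x)) = A (Adag (Sv x)) := fun x => DFunLike.congr_fun hSv_comm x
  have eVi : ∀ x, Sv (Svinv x) = x := fun x => DFunLike.congr_fun hSv_inv₁ x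
  have eiV : ∀ x, Svinv (Sv x) = x := fun x => DFunLike.congr_fun hSv_inv₂ x
  set As := ContinuousLinearMap.adjoint A
  set Ads := ContinuousLinearMap.adjoint Adag
  have e7 : ∀ x, A (Adag (Ads x)) = Ads x := by
    intro x
    rw [← e3, e4, e6]
  have hQR : ∀ x, Adag (Sv (Ads (As (Svinv (A x))))) = Adag (A x) := by
    intro x
    rw [e3, eV, eVi, e1]
  constructor
  · have hunit := isUnit_one_add_mul_of_corner_inverse (M := H₁ →L[ℝ] H₁)
      (P := Adag.comp A) (Q := Adag.comp (Sv.comp Ads)) (R := As.comp (Svinv.comp A)) (U := Su)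
      hSu_comm
      (by ext x; simp [e2])
      (by ext x; simp [e6])
      (by ext x; simp [e5])
      (by ext x; simp [e1])
      (by ext x; simp [← eV, eiV, e7, e4])
      (by ext x; simp [hQR])
      (ContinuousLinearMap.isUnit_iff_bijective.mpr hbij)
    have hbijT := ContinuousLinearMap.isUnit_iff_bijective.mp hunit
    convert hbijT using 2
    ext x
    simp [e4]
  · intro y z hyz
    simp only [add_apply, ContinuousLinearMap.comp_apply,
      ContinuousLinearMap.id_apply, e4] at hyz ⊢
    have hPz : Adag (A z) = As (Svinv (A y)) := by
      apply hbij.injective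
      have h := congrArg (fun x => Adag (A x)) hyz
      simp only [map_add, e2, eU, e5] at h
      simp only [add_apply, ContinuousLinearMap.comp_apply, e6, hQR]
      rw [← h, add_comm]
    rw [← hQR, ← hPz, e6]
end

section
/- (Deterministic form of Theorem 3.1.) Let H₁ and H₂ be real Hilbert spaces, A : H₁ → H₂ and A† : H₂ → H₁ bounded operators satisfying the Moore–Penrose equations, Π := A† A. Let Σ_u : H₁ → H₁ be bounded self-adjoint positive with Π Σ_u = Σ_u Π, and Σ_v : H₂ → H₂ bounded self-adjoint positive bijective commuting with A A†. Set Q_v := A† Σ_v (A†)*, assume Σ_u + Q_v is bijective, let B̂ := (A†)* Σ_u A* Σ_v⁻¹ (so that I + A* B̂ A is bijective), fix y₀ ∈ Ker A, and define the best-predictor map g(x) := y₀ + Q_v (Σ_u + Q_v)⁻¹ (x − y₀). Then for every bounded self-adjoint operator B : H₂ → H₂ satisfying the positivity condition ⟨A h, B (A h)⟩ ≥ 0 for all h ∈ H₁, and for every x ∈ H₁: ‖g(x) − (I + A* B̂ A)⁻¹ x‖ ≤ ‖g(x) − (I + A* B A)⁻¹ x‖. -/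
open RealInnerProductSpace

open ContinuousLinearMap (adjoint)

section Ring

variable {R : Type*} [Ring R] {p s q m c : R}

/-- An element commuting with a unit commutes with its inverse. -/
lemma commute_of_mul_eq_one {t : R} (h : Commute p t) (htm : t * m = 1) (hmt : m * t = 1) :
    Commute p m := by
  calc p * m = m * t * p * m := by rw [hmt, one_mul]
    _ = m * (p * t) * m := by rw [h.eq]; simp only [mul_assoc]
    _ = m * p := by rw [mul_assoc, mul_assoc, htm, mul_one]

/-- If `c` inverts `q` on the corner of the idempotent `p`, and `m` inverts `s + q`, then
`1 - p + q * m` is a right inverse of `1 + s * c`. -/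
lemma one_add_mul_mul_eq_one (hsp : s * p = p * s) (hpq : p * q = q) (hqp : q * p = q)
    (hcp : c * p = c) (hcq : c * q = p)
    (hm : (s + q) * m = 1) (hm' : m * (s + q) = 1) :
    (1 + s * c) * (1 - p + q * m) = 1 := by
  have hpm : p * m = m * p :=
    commute_of_mul_eq_one (t := s + q)
      (by rw [commute_iff_eq, mul_add, add_mul, hsp, hpq, hqp]) hm hm'
  calc (1 + s * c) * (1 - p + q * m)
      = 1 - p + q * m + (s * (c - c * p) + s * (c * q) * m) := by noncomm_ring
    _ = 1 - p + (q * p * m + s * p * m) := by rw [hcp, hcq, hqp, sub_self, mul_zero, zero_add,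
          add_assoc]
    _ = 1 - p + (s + q) * m * p := by
          rw [mul_assoc, mul_assoc, hpm]; noncomm_ring
    _ = 1 := by rw [hm, one_mul, sub_add_cancel]

/-- If `c` inverts `q` on the corner of the idempotent `p`, and `m` inverts `s + q`, then
`1 - p + q * m` is a left inverse of `1 + s * c`. -/
lemma mul_one_add_mul_eq_one (hsp : s * p = p * s) (hpq : p * q = q) (hqp : q * p = q)
    (hpc : p * c = c) (hqc : q * c = p)
    (hm : (s + q) * m = 1) (hm' : m * (s + q) = 1) :
    (1 - p + q * m) * (1 + s * c) = 1 := by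
  have hpm : p * m = m * p :=
    commute_of_mul_eq_one (t := s + q)
      (by rw [commute_iff_eq, mul_add, add_mul, hsp, hpq, hqp]) hm hm'
  have hqmp : q * m * p = q * m := by rw [mul_assoc, ← hpm, ← mul_assoc, hqp]
  have hpsc : p * s * c = s * c := by rw [← hsp, mul_assoc, hpc]
  calc (1 - p + q * m) * (1 + s * c)
      = 1 - p + (s * c - p * s * c) + (q * m + q * (m * (s + q)) * c - q * m * (q * c)) := by
        noncomm_ring
    _ = 1 := by
        rw [hpsc, hm', hqc, hqmp, mul_one, hqc]
        noncomm_ring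

end Ring

/-- The operator `1 + A* B A` is invertible as soon as `B` is nonnegative on the range of `A`. -/
lemma bijective_id_add_adjoint_comp
    {H₁ H₂ : Type*} [NormedAddCommGroup H₁] [InnerProductSpace ℝ H₁] [CompleteSpace H₁]
    [NormedAddCommGroup H₂] [InnerProductSpace ℝ H₂] [CompleteSpace H₂]
    (A : H₁ →L[ℝ] H₂) (B : H₂ →L[ℝ] H₂) (hB : ∀ h : H₁, 0 ≤ ⟪A h, B (A h)⟫) :
    Function.Bijective ⇑(ContinuousLinearMap.id ℝ H₁ + (adjoint A).comp (B.comp A)) := by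
  refine ContinuousLinearMap.isUnit_iff_bijective.mp
    (ContinuousLinearMap.isUnit_of_forall_le_norm_inner_map _ one_pos fun x => ?_)
  refine le_trans ?_ (Real.le_norm_self _)
  simp only [NNReal.coe_one, mul_one, add_apply, ContinuousLinearMap.id_apply,
    ContinuousLinearMap.comp_apply, inner_add_left, real_inner_self_eq_norm_sq,
    ContinuousLinearMap.adjoint_inner_left]
  rw [real_inner_comm]
  exact le_add_of_nonneg_right (hB x)

/-- The complement of an orthogonal projection does not increase norms. -/
lemma norm_sub_apply_le_of_isSelfAdjoint_of_idempotent
    {H : Type*} [NormedAddCommGroup H] [InnerProductSpace ℝ H] [CompleteSpace H]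
    {P : H →L[ℝ] H} (hP : adjoint P = P) (hPP : P * P = P) (w : H) : ‖w - P w‖ ≤ ‖w‖ := by
  have hPw : P (P w) = P w := congr($hPP w)
  have horth : ⟪w - P w, P w⟫ = 0 := by
    rw [← ContinuousLinearMap.adjoint_inner_left, hP, map_sub, hPw, sub_self, inner_zero_left]
  have hpyth := norm_add_sq_eq_norm_sq_add_norm_sq_real horth
  rw [sub_add_cancel] at hpyth
  nlinarith [norm_nonneg (w - P w), norm_nonneg w, mul_self_nonneg ‖P w‖]

/-- **deterministic form of Theorem 3.1.** With `(A, A†)` a Moore–Penrose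
pair, `Π := A† A`, `Σ_u` bounded self-adjoint positive commuting with `Π`, `Σ_v` bounded
self-adjoint positive bijective commuting with `A A†`, `Q_v := A† Σ_v (A†)*` with
`Σ_u + Q_v` bijective (with bounded inverse `M`), `B̂ := (A†)* Σ_u A* Σ_v⁻¹`, `y₀ ∈ Ker A`
and `g x := y₀ + Q_v (M (x - y₀))`: the operator `I + A* B̂ A` is bijective, and for every
admissible smoothing operator `B` (bounded, self-adjoint, `⟪A h, B (A h)⟫ ≥ 0`) the operator
`I + A* B A` is bijective and
`‖g x - (I + A* B̂ A)⁻¹ x‖ ≤ ‖g x - (I + A* B A)⁻¹ x‖` for every `x`. -/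
theorem optimal_smoothing_operator_minimizes_gap
    {H₁ H₂ : Type*} [NormedAddCommGroup H₁] [InnerProductSpace ℝ H₁] [CompleteSpace H₁]
    [NormedAddCommGroup H₂] [InnerProductSpace ℝ H₂] [CompleteSpace H₂]
    (A : H₁ →L[ℝ] H₂) (Adag : H₂ →L[ℝ] H₁)
    (h1 : A.comp (Adag.comp A) = A)
    (h2 : Adag.comp (A.comp Adag) = Adag)
    (h3 : ContinuousLinearMap.adjoint (A.comp Adag) = A.comp Adag)
    (h4 : ContinuousLinearMap.adjoint (Adag.comp A) = Adag.comp A)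
    (Su : H₁ →L[ℝ] H₁) (hSu_sa : IsSelfAdjoint Su) (hSu_pos : ∀ h : H₁, 0 ≤ ⟪Su h, h⟫)
    (hSu_comm : (Adag.comp A).comp Su = Su.comp (Adag.comp A))
    (Sv : H₂ →L[ℝ] H₂) (hSv_sa : IsSelfAdjoint Sv) (hSv_pos : ∀ h : H₂, 0 ≤ ⟪Sv h, h⟫)
    (Svinv : H₂ →L[ℝ] H₂)
    (hSv_inv₁ : Sv.comp Svinv = ContinuousLinearMap.id ℝ H₂)
    (hSv_inv₂ : Svinv.comp Sv = ContinuousLinearMap.id ℝ H₂)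
    (hSv_comm : Sv.comp (A.comp Adag) = (A.comp Adag).comp Sv)
    -- `Q_v := A† Σ_v (A†)*` and `M := (Σ_u + Q_v)⁻¹`
    (M : H₁ →L[ℝ] H₁)
    (hM₁ : (Su + Adag.comp (Sv.comp (ContinuousLinearMap.adjoint Adag))).comp M =
      ContinuousLinearMap.id ℝ H₁)
    (hM₂ : M.comp (Su + Adag.comp (Sv.comp (ContinuousLinearMap.adjoint Adag))) =
      ContinuousLinearMap.id ℝ H₁)
    (y₀ : H₁) (hy₀ : A y₀ = 0) :
    Function.Bijective
      ⇑(ContinuousLinearMap.id ℝ H₁ +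
        (ContinuousLinearMap.adjoint A).comp
          (((ContinuousLinearMap.adjoint Adag).comp
              (Su.comp ((ContinuousLinearMap.adjoint A).comp Svinv))).comp A)) ∧
    ∀ B : H₂ →L[ℝ] H₂, IsSelfAdjoint B → (∀ h : H₁, 0 ≤ ⟪A h, B (A h)⟫) →
      Function.Bijective
        ⇑(ContinuousLinearMap.id ℝ H₁ +
          (ContinuousLinearMap.adjoint A).comp (B.comp A)) ∧
      ∀ x yhat yB : H₁,
        (ContinuousLinearMap.id ℝ H₁ +
            (ContinuousLinearMap.adjoint A).comp
              (((ContinuousLinearMap.adjoint Adag).comp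
                  (Su.comp ((ContinuousLinearMap.adjoint A).comp Svinv))).comp A)) yhat = x →
        (ContinuousLinearMap.id ℝ H₁ +
            (ContinuousLinearMap.adjoint A).comp (B.comp A)) yB = x →
        ‖(y₀ + (Adag.comp (Sv.comp (ContinuousLinearMap.adjoint Adag))) (M (x - y₀))) - yhat‖ ≤
          ‖(y₀ + (Adag.comp (Sv.comp (ContinuousLinearMap.adjoint Adag))) (M (x - y₀))) - yB‖ := by
  set P := Adag.comp A with hP
  set Q := Adag.comp (Sv.comp (adjoint Adag)) with hQ
  set C := (adjoint A).comp (Svinv.comp A) with hC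
  have hPP : P * P = P := by
    ext z; exact congr(Adag ($h1 z))
  have hAadj : P.comp (adjoint A) = adjoint A := by
    rw [← h4, ← ContinuousLinearMap.adjoint_comp, h1]
  have hAdagadj : (adjoint Adag).comp P = adjoint Adag := by
    rw [← h4, ← ContinuousLinearMap.adjoint_comp]
    exact congrArg adjoint h2
  have hadj₁ : (adjoint A).comp (adjoint Adag) = P := by
    rw [← ContinuousLinearMap.adjoint_comp, h4]
  have hadj₂ : (adjoint Adag).comp (adjoint A) = A.comp Adag := by
    rw [← ContinuousLinearMap.adjoint_comp, h3]
  have hsp : Su * P = P * Su := hSu_comm.symm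
  have hpq : P * Q = Q := by
    ext z; exact congr($h2 (Sv (adjoint Adag z)))
  have hqp : Q * P = Q := by
    ext z; exact congr(Adag (Sv ($hAdagadj z)))
  have hpc : P * C = C := by
    ext z; exact congr($hAadj (Svinv (A z)))
  have hcp : C * P = C := by
    ext z; exact congr(adjoint A (Svinv ($h1 z)))
  have hqc : Q * C = P := by
    ext z
    calc Adag (Sv (adjoint Adag (adjoint A (Svinv (A z)))))
        = Adag (Sv (A (Adag (Svinv (A z))))) := congr(Adag (Sv ($hadj₂ (Svinv (A z)))))
      _ = Adag (A (Adag (Sv (Svinv (A z))))) := congr(Adag ($hSv_comm (Svinv (A z))))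
      _ = Adag (Sv (Svinv (A z))) := congr($h2 (Sv (Svinv (A z))))
      _ = Adag (A z) := congr(Adag ($hSv_inv₁ (A z)))
  have hcq : C * Q = P := by
    ext z
    calc adjoint A (Svinv (A (Adag (Sv (adjoint Adag z)))))
        = adjoint A (Svinv (Sv (A (Adag (adjoint Adag z))))) :=
          congr(adjoint A (Svinv ($hSv_comm.symm (adjoint Adag z))))
      _ = adjoint A (A (Adag (adjoint Adag z))) :=
          congr(adjoint A ($hSv_inv₂ (A (Adag (adjoint Adag z)))))
      _ = adjoint A (adjoint Adag (adjoint A (adjoint Adag z))) :=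
          congr(adjoint A ($hadj₂.symm (adjoint Adag z)))
      _ = P (P z) := by simp only [← hadj₁, ContinuousLinearMap.comp_apply]
      _ = P z := congr($hPP z)
  have hK : ContinuousLinearMap.id ℝ H₁ + (adjoint A).comp
      (((adjoint Adag).comp (Su.comp ((adjoint A).comp Svinv))).comp A) = 1 + Su * C := by
    ext z
    refine congrArg (z + ·) ?_
    calc adjoint A (adjoint Adag (Su (C z))) = P (Su (C z)) := congr($hadj₁ (Su (C z)))
      _ = Su (P (C z)) := congr($hSu_comm (C z))
      _ = Su (C z) := congr(Su ($hpc z))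
  have hright := one_add_mul_mul_eq_one hsp hpq hqp hcp hcq hM₁ hM₂
  have hleft := mul_one_add_mul_eq_one hsp hpq hqp hpc hqc hM₁ hM₂
  have hPM : P * M = M * P :=
    commute_of_mul_eq_one (t := Su + Q)
      (by rw [commute_iff_eq, mul_add, add_mul, hsp, hpq, hqp]) hM₁ hM₂
  have hPy₀ : P y₀ = 0 := by simp [hP, hy₀]
  have hQMy₀ : Q (M y₀) = 0 := by
    calc Q (M y₀) = Q (P (M y₀)) := congr($hqp.symm (M y₀))
      _ = Q (M (P y₀)) := congr(Q ($hPM y₀))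
      _ = 0 := by rw [hPy₀, map_zero, map_zero]
  rw [hK]
  refine ⟨ContinuousLinearMap.isUnit_iff_bijective.mp ⟨⟨_, _, hright, hleft⟩, rfl⟩, ?_⟩
  intro B _ hB
  refine ⟨bijective_id_add_adjoint_comp A B hB, ?_⟩
  intro x yhat yB hyhat hyB
  have hyhat' : yhat = x - P x + Q (M x) := by
    rw [← hyhat]
    exact congr($hleft.symm yhat)
  have hPyB : yB - P yB = x - P x := by
    have hfix : P (adjoint A (B (A yB))) = adjoint A (B (A yB)) := congr($hAadj (B (A yB)))
    rw [← hyB]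
    simp only [add_apply, ContinuousLinearMap.id_apply,
      ContinuousLinearMap.comp_apply, map_add, hfix]
    abel
  have hPQM : P (Q (M x)) = Q (M x) := congr($hpq (M x))
  have hgap : y₀ + Q (M (x - y₀)) - yhat =
      (y₀ + Q (M (x - y₀)) - yB) - P (y₀ + Q (M (x - y₀)) - yB) := by
    simp only [map_sub, map_add, hQMy₀, hPy₀, hPQM, hyhat', sub_zero, zero_add]
    rw [← sub_eq_zero]
    rw [← sub_eq_zero] at hPyB
    rw [← hPyB]
    abel
  rw [hgap]
  exact norm_sub_apply_le_of_isSelfAdjoint_of_idempotent h4 hPP _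
end

section
/- Let H be a separable real Hilbert space with Hilbert basis (e_n)_{n ∈ ℕ}, let λ : ℕ → ℝ and β : ℕ → ℝ with β_n ≥ 0 for all n, and let x ∈ H. Define y* := ∑_n (1 + β_n λ_n²)⁻¹ ⟨x, e_n⟩ e_n. Then: (i) the series defining y* converges in H and the family (β_n λ_n² ⟨y*, e_n⟩²) is summable; (ii) for every y ∈ H such that (β_n λ_n² ⟨y, e_n⟩²) is summable, ‖x − y*‖² + ∑_n β_n λ_n² ⟨y*, e_n⟩² ≤ ‖x − y‖² + ∑_n β_n λ_n² ⟨y, e_n⟩², with equality only if y = y*. -/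
open RealInnerProductSpace

/-- Parseval's identity for a real Hilbert basis. -/
theorem HilbertBasis.hasSum_real_inner_sq {ι H : Type*} [NormedAddCommGroup H]
    [InnerProductSpace ℝ H] (e : HilbertBasis ι ℝ H) (z : H) :
    HasSum (fun i => ⟪z, e i⟫ ^ 2) (‖z‖ ^ 2) := by
  have h := e.hasSum_inner_mul_inner z z
  rw [real_inner_self_eq_norm_sq] at h
  refine h.congr_fun fun i => ?_
  rw [real_inner_comm z (e i), sq]

/-- A Fourier multiplier bounded by one in absolute value maps `x` to a vector of the space. -/
theorem HilbertBasis.exists_hasSum_multiplier {ι H : Type*} [NormedAddCommGroup H]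
    [InnerProductSpace ℝ H] (e : HilbertBasis ι ℝ H) (m : ι → ℝ) (hm : ∀ i, |m i| ≤ 1) (x : H) :
    ∃ z : H, HasSum (fun i => (m i * ⟪x, e i⟫) • e i) z ∧ ∀ i, ⟪z, e i⟫ = m i * ⟪x, e i⟫ := by
  have hmem : Memℓp (E := fun _ : ι => ℝ) (fun i => m i * ⟪x, e i⟫) 2 := by
    refine (lp.memℓp (e.repr x)).mono' fun i => ?_
    rw [e.repr_apply_apply, real_inner_comm, norm_mul]
    exact mul_le_of_le_one_left (norm_nonneg _) (hm i)
  refine ⟨e.repr.symm ⟨_, hmem⟩, e.hasSum_repr_symm ⟨_, hmem⟩, fun i => ?_⟩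
  rw [real_inner_comm, ← e.repr_apply_apply, LinearIsometryEquiv.apply_symm_apply]

/-- The scalar functional `t ↦ (a - t)² + c t²` grows at least quadratically away from its
minimizer `(1 + c)⁻¹ a`. -/
theorem scalar_HP_quadratic_growth {c : ℝ} (hc : 0 ≤ c) (a t : ℝ) :
    (a - (1 + c)⁻¹ * a) ^ 2 + c * ((1 + c)⁻¹ * a) ^ 2 + (t - (1 + c)⁻¹ * a) ^ 2 ≤
      (a - t) ^ 2 + c * t ^ 2 := by
  obtain ⟨s, hs⟩ : ∃ s, s = (1 + c)⁻¹ * a := ⟨_, rfl⟩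
  have ha : a = (1 + c) * s := by
    rw [hs, mul_inv_cancel_left₀ (by positivity)]
  rw [← hs, ha]
  nlinarith [mul_nonneg hc (sq_nonneg (t - s))]

/-- **diagonal Hodrick–Prescott minimization.** Given a Hilbert basis
`(e_n)` of a separable real Hilbert space `H`, eigenvalues `λ_n`, nonnegative smoothing
coefficients `β_n` and data `x`, the series `y* = ∑ (1 + β_n λ_n²)⁻¹ ⟨x, e_n⟩ e_n`
converges, `(β_n λ_n² ⟨y*, e_n⟩²)` is summable, and `y*` is the unique minimizer of
`‖x − y‖² + ∑ β_n λ_n² ⟨y, e_n⟩²` among all `y` for which this sum is finite. -/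
theorem diagonal_HP_minimizer
    {H : Type*} [NormedAddCommGroup H] [InnerProductSpace ℝ H] [CompleteSpace H]
    (e : HilbertBasis ℕ ℝ H) (lam β : ℕ → ℝ) (hβ : ∀ n, 0 ≤ β n) (x : H) :
    Summable (fun n => ((1 + β n * lam n ^ 2)⁻¹ * ⟪x, e n⟫) • e n) ∧
    ∀ ystar : H, ystar = ∑' n, ((1 + β n * lam n ^ 2)⁻¹ * ⟪x, e n⟫) • e n →
      Summable (fun n => β n * lam n ^ 2 * ⟪ystar, e n⟫ ^ 2) ∧
      ∀ y : H, Summable (fun n => β n * lam n ^ 2 * ⟪y, e n⟫ ^ 2) →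
        (‖x - ystar‖ ^ 2 + ∑' n, β n * lam n ^ 2 * ⟪ystar, e n⟫ ^ 2 ≤
            ‖x - y‖ ^ 2 + ∑' n, β n * lam n ^ 2 * ⟪y, e n⟫ ^ 2) ∧
        (‖x - y‖ ^ 2 + ∑' n, β n * lam n ^ 2 * ⟪y, e n⟫ ^ 2 =
            ‖x - ystar‖ ^ 2 + ∑' n, β n * lam n ^ 2 * ⟪ystar, e n⟫ ^ 2 → y = ystar) := by
  have hc : ∀ n, 0 ≤ β n * lam n ^ 2 := fun n => mul_nonneg (hβ n) (sq_nonneg _)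
  have hm : ∀ n, |(1 + β n * lam n ^ 2)⁻¹| ≤ 1 := fun n => by
    have := hc n
    rw [abs_of_nonneg (by positivity)]
    exact inv_le_one_of_one_le₀ (by linarith)
  obtain ⟨z, hz, hcoord⟩ := e.exists_hasSum_multiplier _ hm x
  refine ⟨hz.summable, ?_⟩
  rintro ystar rfl
  rw [hz.tsum_eq]
  have hgrowth (y : H) (n : ℕ) :
      ⟪x - z, e n⟫ ^ 2 + β n * lam n ^ 2 * ⟪z, e n⟫ ^ 2 + ⟪y - z, e n⟫ ^ 2 ≤
        ⟪x - y, e n⟫ ^ 2 + β n * lam n ^ 2 * ⟪y, e n⟫ ^ 2 := by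
    simp only [inner_sub_left, hcoord]
    exact scalar_HP_quadratic_growth (hc n) _ _
  have hsum : Summable (fun n => β n * lam n ^ 2 * ⟪z, e n⟫ ^ 2) := by
    refine (e.hasSum_real_inner_sq x).summable.of_nonneg_of_le
      (fun n => mul_nonneg (hc n) (sq_nonneg _)) fun n => ?_
    have h := hgrowth 0 n
    simp only [sub_zero, inner_zero_left] at h
    nlinarith [sq_nonneg ⟪x - z, e n⟫, sq_nonneg ⟪0 - z, e n⟫]
  refine ⟨hsum, fun y hy => ?_⟩
  have key := hasSum_le (hgrowth y)
    (((e.hasSum_real_inner_sq (x - z)).add hsum.hasSum).add (e.hasSum_real_inner_sq (y - z)))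
    ((e.hasSum_real_inner_sq (x - y)).add hy.hasSum)
  refine ⟨by linarith [sq_nonneg ‖y - z‖], fun heq => ?_⟩
  have hnorm : ‖y - z‖ ^ 2 = 0 := le_antisymm (by linarith) (sq_nonneg _)
  exact sub_eq_zero.mp (norm_eq_zero.mp (pow_eq_zero_iff two_ne_zero |>.mp hnorm))
end
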